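/- arXiv:2510.13498 — 6 statements merged into one kernel-verified Lean document; each statement's English description precedes it below -/
import Mathlib

section
/- Let 0 ≤ θ̄ < π/2 and 0 ≤ φ̄ < π/2, let γ_a = tan θ̄ and γ_e = tan φ̄, and let (x, y, z) ∈ ℝ³ satisfy (x, y) ≠ (0, 0) and (x, z) ≠ (0, 0). Define θ = atan2(y, x) and φ = atan2(z, x) (i.e., θ is the argument of the complex number x + y·i and φ the argument of x + z·i, taking values in (-π, π]). Then (-θ̄ ≤ θ ≤ θ̄ and -φ̄ ≤ φ ≤ φ̄) holds if and only if (x > 0 and -γ_a x ≤ y ≤ γ_a x and -γ_e x ≤ z ≤ γ_e x). -/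
theorem arg_bound_aux (b : ℝ) (hb0 : 0 ≤ b) (hb1 : b < Real.pi / 2) (x y : ℝ)
    (hxy : (x, y) ≠ (0, 0)) :
    (-b ≤ Complex.arg ((x : ℂ) + (y : ℂ) * Complex.I) ∧
      Complex.arg ((x : ℂ) + (y : ℂ) * Complex.I) ≤ b) ↔
    (0 < x ∧ -(Real.tan b * x) ≤ y ∧ y ≤ Real.tan b * x) := by
  set w : ℂ := (x : ℂ) + (y : ℂ) * Complex.I with hw
  have hre : w.re = x := by simp [hw]
  have him : w.im = y := by simp [hw]
  have hw0 : w ≠ 0 := by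
    intro h
    apply hxy
    rw [← hre, ← him, h]
    simp
  have hiff : |w.arg| < Real.pi / 2 ↔ 0 < x := by
    rw [Complex.abs_arg_lt_pi_div_two_iff, hre]
    simp [hw0]
  have key : 0 < x → ((-b ≤ w.arg ∧ w.arg ≤ b) ↔
      (-(Real.tan b * x) ≤ y ∧ y ≤ Real.tan b * x)) := by
    intro hx
    have ha := abs_lt.mp (hiff.mpr hx)
    have e1 : w.arg = Real.arctan (y / x) := by
      rw [← Real.arctan_tan ha.1 ha.2, Complex.tan_arg, hre, him]
    have e2 : b = Real.arctan (Real.tan b) :=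
      (Real.arctan_tan (by linarith) hb1).symm
    have h1 : w.arg ≤ b ↔ y ≤ Real.tan b * x := by
      rw [e1]
      conv_lhs => rw [e2]
      rw [Real.arctan_le_arctan_iff, div_le_iff₀ hx]
    have h2 : -b ≤ w.arg ↔ -(Real.tan b * x) ≤ y := by
      rw [e1]
      conv_lhs => rw [e2]
      rw [← Real.arctan_neg, Real.arctan_le_arctan_iff, le_div_iff₀ hx, neg_mul]
    rw [h1, h2]
  constructor
  · intro h
    have hx : 0 < x := hiff.mp (lt_of_le_of_lt (abs_le.mpr h) hb1)
    exact ⟨hx, (key hx).mp h⟩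
  · rintro ⟨hx, h⟩
    exact (key hx).mpr h

/-- Equivalence between the angle constraints (2) and the linear constraints (3):
with `θ = atan2(y,x)` (the principal argument of `x + y i`) and
`φ = atan2(z,x)`, the box bounds on the angles are equivalent to
`x > 0`, `-γ_a x ≤ y ≤ γ_a x`, `-γ_e x ≤ z ≤ γ_e x`. -/
theorem stmt_3 (θb φb : ℝ) (hθb0 : 0 ≤ θb) (hθb1 : θb < Real.pi / 2)
    (hφb0 : 0 ≤ φb) (hφb1 : φb < Real.pi / 2)
    (γa γe : ℝ) (hγa : γa = Real.tan θb) (hγe : γe = Real.tan φb)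
    (x y z : ℝ) (hxy : (x, y) ≠ (0, 0)) (hxz : (x, z) ≠ (0, 0))
    (θ φ : ℝ)
    (hθ : θ = Complex.arg ((x : ℂ) + (y : ℂ) * Complex.I))
    (hφ : φ = Complex.arg ((x : ℂ) + (z : ℂ) * Complex.I)) :
    (-θb ≤ θ ∧ θ ≤ θb ∧ -φb ≤ φ ∧ φ ≤ φb) ↔
      (0 < x ∧ -(γa * x) ≤ y ∧ y ≤ γa * x ∧ -(γe * x) ≤ z ∧ z ≤ γe * x) := by
  subst hγa hγe hθ hφ
  have h1 := arg_bound_aux θb hθb0 hθb1 x y hxy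
  have h2 := arg_bound_aux φb hφb0 hφb1 x z hxz
  tauto
end

section
/- Let b > 0, γ_a > 0, γ_e > 0 and let (x_i, y_i, z_i) ∈ ℝ³ be fixed. Then the function x ↦ ‖x - (x_i, y_i, z_i)‖² attains both a minimum and a maximum over Ω, the function h_i attains both a minimum and a maximum over V, and the corresponding optimal values coincide: min_{x ∈ Ω} ‖x - (x_i, y_i, z_i)‖² = min_{v ∈ V} h_i(v) and max_{x ∈ Ω} ‖x - (x_i, y_i, z_i)‖² = max_{v ∈ V} h_i(v). -/
/-- The function `h_i` of Lemma 1. -/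
noncomputable def hfun (b xi yi zi : ℝ) (v : ℝ × ℝ) : ℝ :=
  -2 * b * (xi + yi * v.1 + zi * v.2) / Real.sqrt (1 + v.1 ^ 2 + v.2 ^ 2)
    + (xi ^ 2 + yi ^ 2 + zi ^ 2) + b ^ 2

/-- The box `V = [-γ_a, γ_a] × [-γ_e, γ_e]`. -/
def Vbox (γa γe : ℝ) : Set (ℝ × ℝ) := Set.Icc (-γa) γa ×ˢ Set.Icc (-γe) γe

/-- The feasible region `Ω` on the sphere of radius `b`. -/
def Omg (b γa γe : ℝ) : Set (EuclideanSpace ℝ (Fin 3)) :=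
  {p | (p 0) ^ 2 + (p 1) ^ 2 + (p 2) ^ 2 = b ^ 2 ∧
       -(γa * p 0) ≤ p 1 ∧ p 1 ≤ γa * p 0 ∧
       -(γe * p 0) ≤ p 2 ∧ p 2 ≤ γe * p 0 ∧ 0 < p 0}

/-- The bound problems over `Ω` are attained and equivalent to the
two-dimensional box-constrained problems over `V`. -/
theorem stmt_5 (b γa γe xi yi zi : ℝ) (hb : 0 < b) (hγa : 0 < γa) (hγe : 0 < γe)
    (q : EuclideanSpace ℝ (Fin 3))
    (hq : q = (WithLp.equiv 2 (Fin 3 → ℝ)).symm ![xi, yi, zi]) :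
    (∃ pmin ∈ Omg b γa γe, ∃ vmin ∈ Vbox γa γe,
      (∀ p ∈ Omg b γa γe, ‖pmin - q‖ ^ 2 ≤ ‖p - q‖ ^ 2) ∧
      (∀ v ∈ Vbox γa γe, hfun b xi yi zi vmin ≤ hfun b xi yi zi v) ∧
      ‖pmin - q‖ ^ 2 = hfun b xi yi zi vmin) ∧
    (∃ pmax ∈ Omg b γa γe, ∃ vmax ∈ Vbox γa γe,
      (∀ p ∈ Omg b γa γe, ‖p - q‖ ^ 2 ≤ ‖pmax - q‖ ^ 2) ∧
      (∀ v ∈ Vbox γa γe, hfun b xi yi zi v ≤ hfun b xi yi zi vmax) ∧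
      ‖pmax - q‖ ^ 2 = hfun b xi yi zi vmax) := by
  have hN : ∀ p : EuclideanSpace ℝ (Fin 3),
      ‖p - q‖ ^ 2 = (p 0 - xi) ^ 2 + (p 1 - yi) ^ 2 + (p 2 - zi) ^ 2 := by
    intro p
    subst hq
    simp [EuclideanSpace.norm_sq_eq, Fin.sum_univ_three]
  have hA : ∀ v ∈ Vbox γa γe, ∃ p ∈ Omg b γa γe, ‖p - q‖ ^ 2 = hfun b xi yi zi v := by
    rintro ⟨v, w⟩ ⟨⟨h1, h2⟩, ⟨h3, h4⟩⟩
    simp only at h1 h2 h3 h4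
    have hpos : 0 < 1 + v ^ 2 + w ^ 2 := by positivity
    obtain ⟨s, hs⟩ : ∃ s, s = Real.sqrt (1 + v ^ 2 + w ^ 2) := ⟨_, rfl⟩
    have hs0 : 0 < s := hs ▸ Real.sqrt_pos.2 hpos
    have hs2 : s ^ 2 = 1 + v ^ 2 + w ^ 2 := by rw [hs, Real.sq_sqrt hpos.le]
    obtain ⟨t, ht⟩ : ∃ t, t = b / s := ⟨_, rfl⟩
    have ht0 : 0 < t := ht ▸ div_pos hb hs0
    have hts : t ^ 2 * (1 + v ^ 2 + w ^ 2) = b ^ 2 := by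
      rw [← hs2, ht]; field_simp
    refine ⟨!₂[t, t * v, t * w], ?_, ?_⟩
    · simp only [Omg, Set.mem_setOf_eq]
      simp
      refine ⟨by linarith, by nlinarith, by nlinarith, by nlinarith, by nlinarith, ht0⟩
    · rw [hN]
      simp only [hfun, ← hs]
      have e : -2 * b * (xi + yi * v + zi * w) / s = -2 * t * (xi + yi * v + zi * w) := by
        rw [ht]; ring
      rw [e]
      simp
      linarith
  have hB : ∀ p ∈ Omg b γa γe, ∃ v ∈ Vbox γa γe, ‖p - q‖ ^ 2 = hfun b xi yi zi v := by
    rintro p ⟨h0, h1, h2, h3, h4, hp⟩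
    refine ⟨(p 1 / p 0, p 2 / p 0), ⟨⟨?_, ?_⟩, ⟨?_, ?_⟩⟩, ?_⟩
    · simp only; rw [le_div_iff₀ hp]; linarith
    · simp only; rw [div_le_iff₀ hp]; linarith
    · simp only; rw [le_div_iff₀ hp]; linarith
    · simp only; rw [div_le_iff₀ hp]; linarith
    · rw [hN]
      have e : Real.sqrt (1 + (p 1 / p 0) ^ 2 + (p 2 / p 0) ^ 2) = b / p 0 := by
        rw [← Real.sqrt_sq (div_pos hb hp).le]
        congr 1
        rw [div_pow b, ← h0]; field_simp
      simp only [hfun, e]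
      have e2 : -2 * b * (xi + yi * (p 1 / p 0) + zi * (p 2 / p 0)) / (b / p 0)
          = -2 * (xi * p 0 + yi * p 1 + zi * p 2) := by
        field_simp
      rw [e2]
      linarith
  have hK : IsCompact (Vbox γa γe) := isCompact_Icc.prod isCompact_Icc
  have hne : (Vbox γa γe).Nonempty :=
    ⟨(0, 0), ⟨⟨by simp; linarith, by simp; linarith⟩, ⟨by simp; linarith, by simp; linarith⟩⟩⟩
  have hc : Continuous (hfun b xi yi zi) := by
    unfold hfun
    have : ∀ v : ℝ × ℝ, Real.sqrt (1 + v.1 ^ 2 + v.2 ^ 2) ≠ 0 := fun v =>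
      (Real.sqrt_pos.2 (by positivity)).ne'
    fun_prop (disch := assumption)
  constructor
  · obtain ⟨v, hv, hmin⟩ := hK.exists_isMinOn hne hc.continuousOn
    obtain ⟨p, hp, hpv⟩ := hA v hv
    refine ⟨p, hp, v, hv, fun p' hp' => ?_, fun v' hv' => hmin hv', hpv⟩
    obtain ⟨v', hv', e⟩ := hB p' hp'
    rw [hpv, e]; exact hmin hv'
  · obtain ⟨v, hv, hmax⟩ := hK.exists_isMaxOn hne hc.continuousOn
    obtain ⟨p, hp, hpv⟩ := hA v hv
    refine ⟨p, hp, v, hv, fun p' hp' => ?_, fun v' hv' => hmax hv', hpv⟩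
    obtain ⟨v', hv', e⟩ := hB p' hp'
    rw [hpv, e]; exact hmax hv'
end

section
/- Let b > 0 and (x_i, y_i, z_i) ∈ ℝ³ with x_i > 0. Then for (v₁, v₂) ∈ ℝ², the gradient of h_i vanishes at (v₁, v₂), i.e. v₁(x_i + y_i v₁ + z_i v₂) - y_i(1 + v₁² + v₂²) = 0 and v₂(x_i + y_i v₁ + z_i v₂) - z_i(1 + v₁² + v₂²) = 0, if and only if (v₁, v₂) = (y_i/x_i, z_i/x_i). -/
/-- Case 1 (interior stationarity) of Theorem 1: the gradient of `h_i`
vanishes at `(v₁, v₂)` iff `(v₁, v₂) = (y_i/x_i, z_i/x_i)`. -/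
theorem stmt_6 (b xi yi zi : ℝ) (hb : 0 < b) (hxi : 0 < xi) (v₁ v₂ : ℝ) :
    (v₁ * (xi + yi * v₁ + zi * v₂) - yi * (1 + v₁ ^ 2 + v₂ ^ 2) = 0 ∧
     v₂ * (xi + yi * v₁ + zi * v₂) - zi * (1 + v₁ ^ 2 + v₂ ^ 2) = 0) ↔
    (v₁ = yi / xi ∧ v₂ = zi / xi) := by
  have hN : (1 + v₁ ^ 2 + v₂ ^ 2) ≠ 0 := by positivity
  constructor
  · rintro ⟨h1, h2⟩
    rw [eq_div_iff hxi.ne', eq_div_iff hxi.ne']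
    constructor
    · apply mul_left_cancel₀ hN
      linear_combination (v₁ ^ 2 + 1) * h1 + v₁ * v₂ * h2
    · apply mul_left_cancel₀ hN
      linear_combination (v₂ ^ 2 + 1) * h2 + v₁ * v₂ * h1
  · rintro ⟨h1, h2⟩
    have hx := hxi.ne'
    subst h1 h2
    constructor
    · field_simp
      ring
    · field_simp
      ring
end

section
/- Let b > 0, γ_a > 0 and (x_i, y_i, z_i) ∈ ℝ³ with x_i - γ_a y_i ≠ 0. Set v₂* = (1 + γ_a²)z_i/(x_i - γ_a y_i) and Q₁ = 1 + γ_a² + (1 + γ_a²)² z_i²/(x_i - γ_a y_i)². Then ∂h_i/∂v₁(-γ_a, v₂*) = -2b·((x_i - γ_a y_i)² + (1 + γ_a²)z_i²)·(γ_a x_i + y_i)/(Q₁^{3/2}·(x_i - γ_a y_i)²). In particular, ∂h_i/∂v₁(-γ_a, v₂*) > 0 if and only if γ_a x_i + y_i < 0. -/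
/-- Case 2.1 of Theorem 1: Lagrange multiplier formula and sign condition on
the edge `v₁ = -γ_a`. -/
theorem stmt_11 (b γa xi yi zi : ℝ) (hb : 0 < b) (hγa : 0 < γa)
    (hden : xi - γa * yi ≠ 0)
    (v₂s Q₁ : ℝ)
    (hv₂s : v₂s = (1 + γa ^ 2) * zi / (xi - γa * yi))
    (hQ₁ : Q₁ = 1 + γa ^ 2 + (1 + γa ^ 2) ^ 2 * zi ^ 2 / (xi - γa * yi) ^ 2) :
    deriv (fun t => hfun b xi yi zi (t, v₂s)) (-γa) =
      -2 * b * ((xi - γa * yi) ^ 2 + (1 + γa ^ 2) * zi ^ 2) * (γa * xi + yi)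
        / (Q₁ ^ ((3 : ℝ) / 2) * (xi - γa * yi) ^ 2) ∧
    (0 < deriv (fun t => hfun b xi yi zi (t, v₂s)) (-γa) ↔ γa * xi + yi < 0) := by
  have hD2 : 0 < (xi - γa * yi) ^ 2 := by positivity
  have hQ : Q₁ = 1 + (-γa) ^ 2 + v₂s ^ 2 := by
    rw [hQ₁, hv₂s]; field_simp
  have hQpos : 0 < Q₁ := by rw [hQ]; positivity
  have hS : 0 < Real.sqrt Q₁ := Real.sqrt_pos.mpr hQpos
  have hSS : Real.sqrt Q₁ ^ 2 = Q₁ := Real.sq_sqrt hQpos.le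
  have hpow : Q₁ ^ ((3 : ℝ) / 2) = Real.sqrt Q₁ ^ 3 := by
    rw [Real.sqrt_eq_rpow, ← Real.rpow_natCast, ← Real.rpow_mul hQpos.le]
    norm_num
  have hd1 : HasDerivAt (fun t : ℝ => 1 + t ^ 2 + v₂s ^ 2) (2 * (-γa)) (-γa) := by
    have := (((hasDerivAt_id (-γa)).pow 2).const_add 1).add_const (v₂s ^ 2)
    exact this.congr_deriv (by simp)
  have hd2 := hd1.sqrt (by rw [← hQ]; exact hQpos.ne')
  have hd3 : HasDerivAt (fun t : ℝ => -2 * b * (xi + yi * t + zi * v₂s))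
      (-2 * b * yi) (-γa) := by
    have := ((((hasDerivAt_id (-γa)).const_mul yi).const_add xi).add_const
      (zi * v₂s)).const_mul (-2 * b)
    exact this.congr_deriv (by simp)
  have hd4 := ((hd3.div hd2 (by rw [← hQ]; exact hS.ne')).add_const
    (xi ^ 2 + yi ^ 2 + zi ^ 2)).add_const (b ^ 2)
  have hd5 : deriv (fun t => hfun b xi yi zi (t, v₂s)) (-γa) = _ := hd4.deriv
  rw [← hQ] at hd5
  have key : (-γa * (xi + yi * (-γa) + zi * v₂s) - yi * Q₁) * (xi - γa * yi) ^ 2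
      = -(((xi - γa * yi) ^ 2 + (1 + γa ^ 2) * zi ^ 2) * (γa * xi + yi)) := by
    rw [hQ₁, hv₂s]; field_simp; ring
  have hmain : deriv (fun t => hfun b xi yi zi (t, v₂s)) (-γa) =
      -2 * b * ((xi - γa * yi) ^ 2 + (1 + γa ^ 2) * zi ^ 2) * (γa * xi + yi)
        / (Q₁ ^ ((3 : ℝ) / 2) * (xi - γa * yi) ^ 2) := by
    have h1 : -2 * b * ((xi - γa * yi) ^ 2 + (1 + γa ^ 2) * zi ^ 2) * (γa * xi + yi)
        = 2 * b * ((-γa * (xi + yi * (-γa) + zi * v₂s) - yi * Q₁) * (xi - γa * yi) ^ 2) := by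
      rw [key]; ring
    rw [hd5, hpow, h1, ← mul_assoc, mul_div_mul_right _ _ hD2.ne']
    generalize Real.sqrt Q₁ = S at *
    rw [← hSS]
    field_simp
    ring
  refine ⟨hmain, ?_⟩
  have hN : 0 < 2 * b * ((xi - γa * yi) ^ 2 + (1 + γa ^ 2) * zi ^ 2) := by positivity
  have hP : 0 < Q₁ ^ ((3 : ℝ) / 2) * (xi - γa * yi) ^ 2 := by positivity
  rw [hmain, div_pos_iff_of_pos_right hP]
  constructor
  · intro h
    by_contra hc
    push Not at hc
    nlinarith [mul_nonneg hN.le hc]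
  · intro h
    nlinarith [mul_pos hN (neg_pos.mpr h)]
end

section
/- Let b > 0, γ_e > 0 and (x_i, y_i, z_i) ∈ ℝ³ with x_i - γ_e z_i ≠ 0. Set v₁* = (1 + γ_e²)y_i/(x_i - γ_e z_i) and Q₃ = 1 + γ_e² + (1 + γ_e²)² y_i²/(x_i - γ_e z_i)². Then ∂h_i/∂v₂(v₁*, -γ_e) = -2b·((x_i - γ_e z_i)² + (1 + γ_e²)y_i²)·(γ_e x_i + z_i)/(Q₃^{3/2}·(x_i - γ_e z_i)²). In particular, ∂h_i/∂v₂(v₁*, -γ_e) > 0 if and only if γ_e x_i + z_i < 0. -/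
/-- Case 2.3 of Theorem 1: Lagrange multiplier formula and sign condition on
the edge `v₂ = -γ_e`. -/
theorem stmt_12 (b γe xi yi zi : ℝ) (hb : 0 < b) (hγe : 0 < γe)
    (hden : xi - γe * zi ≠ 0)
    (v₁s Q₃ : ℝ)
    (hv₁s : v₁s = (1 + γe ^ 2) * yi / (xi - γe * zi))
    (hQ₃ : Q₃ = 1 + γe ^ 2 + (1 + γe ^ 2) ^ 2 * yi ^ 2 / (xi - γe * zi) ^ 2) :
    deriv (fun t => hfun b xi yi zi (v₁s, t)) (-γe) =
      -2 * b * ((xi - γe * zi) ^ 2 + (1 + γe ^ 2) * yi ^ 2) * (γe * xi + zi)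
        / (Q₃ ^ ((3 : ℝ) / 2) * (xi - γe * zi) ^ 2) ∧
    (0 < deriv (fun t => hfun b xi yi zi (v₁s, t)) (-γe) ↔ γe * xi + zi < 0) := by
  have hD2 : 0 < (xi - γe * zi) ^ 2 := by positivity
  have hQpos : 0 < Q₃ := by rw [hQ₃]; positivity
  have hQv : Q₃ = 1 + v₁s ^ 2 + (-γe) ^ 2 := by
    rw [hQ₃, hv₁s, div_pow]; ring
  have hpow : Q₃ ^ ((3 : ℝ) / 2) = Real.sqrt Q₃ ^ 3 := by
    rw [Real.sqrt_eq_rpow, ← Real.rpow_natCast, ← Real.rpow_mul hQpos.le]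
    norm_num
  have hS : 0 < Real.sqrt Q₃ := Real.sqrt_pos.mpr hQpos
  have hSS : Real.sqrt Q₃ ^ 2 = Q₃ := Real.sq_sqrt hQpos.le
  have hinner : HasDerivAt (fun t : ℝ => 1 + v₁s ^ 2 + t ^ 2) (2 * (-γe)) (-γe) := by
    simpa using ((hasDerivAt_id (-γe)).pow 2).const_add (1 + v₁s ^ 2)
  have hsq := hinner.sqrt (by rw [← hQv]; exact hQpos.ne')
  have hlin : HasDerivAt (fun t : ℝ => -2 * b * (xi + yi * v₁s + zi * t)) (-2 * b * zi) (-γe) := by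
    simpa using ((((hasDerivAt_id (-γe)).const_mul zi).const_add (xi + yi * v₁s)).const_mul (-2 * b))
  have hd := ((hlin.div hsq (by rw [← hQv]; exact hS.ne')).add_const
    (xi ^ 2 + yi ^ 2 + zi ^ 2)).add_const (b ^ 2)
  have hder : deriv (fun t => hfun b xi yi zi (v₁s, t)) (-γe) = _ := hd.deriv
  rw [← hQv] at hder
  have hnum : (-γe) * (xi + yi * v₁s + zi * (-γe)) - zi * Q₃ =
      -((xi - γe * zi) ^ 2 + (1 + γe ^ 2) * yi ^ 2) * (γe * xi + zi) / (xi - γe * zi) ^ 2 := by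
    rw [hQv, hv₁s]; field_simp; ring
  have hmain : deriv (fun t => hfun b xi yi zi (v₁s, t)) (-γe) =
      -2 * b * ((xi - γe * zi) ^ 2 + (1 + γe ^ 2) * yi ^ 2) * (γe * xi + zi)
        / (Q₃ ^ ((3 : ℝ) / 2) * (xi - γe * zi) ^ 2) := by
    have h1 : deriv (fun t => hfun b xi yi zi (v₁s, t)) (-γe) =
        2 * b * ((-γe) * (xi + yi * v₁s + zi * (-γe)) - zi * Q₃) / Real.sqrt Q₃ ^ 3 := by
      rw [hder]
      generalize Real.sqrt Q₃ = S at *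
      subst hSS
      field_simp
      ring
    rw [h1, hnum, hpow]
    field_simp
  refine ⟨hmain, ?_⟩
  rw [hmain]
  have hP : 0 < Q₃ ^ ((3 : ℝ) / 2) * (xi - γe * zi) ^ 2 := by positivity
  have hK : 0 < 2 * b * ((xi - γe * zi) ^ 2 + (1 + γe ^ 2) * yi ^ 2) := by positivity
  rw [div_pos_iff_of_pos_right hP]
  constructor
  · intro h
    by_contra hc
    push Not at hc
    nlinarith [mul_nonneg hK.le hc]
  · intro h
    nlinarith [mul_pos hK (neg_pos.mpr h)]
end

section
/- Let b > 0, γ_a > 0, γ_e > 0 and (x_i, y_i, z_i) ∈ ℝ³ with (x_i, y_i, z_i) ≠ (0, 0, 0). Suppose v* = (v₁*, v₂*) ∈ V is a local minimizer of h_i on V. Then exactly one of the following cases describes v*, and in each case the stated first-order conditions hold: (a) if |v₁*| < γ_a and |v₂*| < γ_e then x_i ≠ 0 and v* = (y_i/x_i, z_i/x_i); (b) if v₁* = -γ_a and |v₂*| < γ_e then v₂*(x_i - γ_a y_i) = (1 + γ_a²)z_i and ∂h_i/∂v₁(v*) ≥ 0; (c) if v₁* = γ_a and |v₂*| < γ_e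 then v₂*(x_i + γ_a y_i) = (1 + γ_a²)z_i and ∂h_i/∂v₁(v*) ≤ 0; (d) if |v₁*| < γ_a and v₂* = -γ_e then v₁*(x_i - γ_e z_i) = (1 + γ_e²)y_i and ∂h_i/∂v₂(v*) ≥ 0; (e) if |v₁*| < γ_a and v₂* = γ_e then v₁*(x_i + γ_e z_i) = (1 + γ_e²)y_i and ∂h_i/∂v₂(v*) ≤ 0; (f) if v* is one of the four corners (±γ_a, ±γ_e), then the partial derivative in each coordinate is ≥ 0 when that coordinate sits at its lower bound and ≤ 0 when it sits at its upper bound. -/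
theorem aux_deriv (b x y z u w : ℝ) :
    HasDerivAt (fun t => hfun b x y z (t, w))
      (2 * b * (u * (x + z * w) - y * (1 + w ^ 2)) /
        ((1 + u ^ 2 + w ^ 2) * Real.sqrt (1 + u ^ 2 + w ^ 2))) u := by
  have hN : 0 < 1 + u ^ 2 + w ^ 2 := by positivity
  have hs : 0 < Real.sqrt (1 + u ^ 2 + w ^ 2) := Real.sqrt_pos.mpr hN
  have hsq : Real.sqrt (1 + u ^ 2 + w ^ 2) ^ 2 = 1 + u ^ 2 + w ^ 2 := Real.sq_sqrt hN.le
  have h1 : HasDerivAt (fun t : ℝ => 1 + t ^ 2 + w ^ 2) (2 * u) u := by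
    simpa using (((hasDerivAt_id u).pow 2).const_add 1).add_const (w ^ 2)
  have h2 := h1.sqrt hN.ne'
  have h3 : HasDerivAt (fun t : ℝ => -2 * b * (x + y * t + z * w)) (-2 * b * y) u := by
    simpa using ((((hasDerivAt_id u).const_mul y).const_add x).add_const (z * w)).const_mul
      (-2 * b)
  have h4 := ((h3.div h2 hs.ne').add_const (x ^ 2 + y ^ 2 + z ^ 2)).add_const (b ^ 2)
  refine h4.congr_deriv ?_
  generalize Real.sqrt (1 + u ^ 2 + w ^ 2) = s at *
  rw [← hsq]
  field_simp
  rw [hsq]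
  ring

theorem aux_sign (f : ℝ → ℝ) (g t d : ℝ) (ht : t ∈ Set.Icc (-g) g)
    (hd : HasDerivAt f d t) (hm : IsLocalMinOn f (Set.Icc (-g) g) t) :
    (t < g → 0 ≤ d) ∧ (-g < t → d ≤ 0) := by
  have key : ∀ e ∈ Set.Icc (-g) g, 0 ≤ (e - t) * d := by
    intro e he
    have := hm.hasFDerivWithinAt_nonneg hd.hasFDerivAt.hasFDerivWithinAt
      (sub_mem_posTangentConeAt_of_segment_subset
        ((convex_Icc (-g) g).segment_subset ht he))
    simpa using this
  constructor
  · intro h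
    have := key g ⟨by linarith [ht.1, ht.2], le_rfl⟩
    exact nonneg_of_mul_nonneg_right this (by linarith)
  · intro h
    have := key (-g) ⟨le_rfl, by linarith [ht.1, ht.2]⟩
    by_contra hc
    push Not at hc
    nlinarith

theorem aux_swap (b x y z u w : ℝ) : hfun b x y z (u, w) = hfun b x z y (w, u) := by
  unfold hfun
  simp only
  rw [show 1 + u ^ 2 + w ^ 2 = 1 + w ^ 2 + u ^ 2 by ring]
  ring

theorem aux_zero (b x y z u w : ℝ) (hb : 0 < b)
    (h : 2 * b * (u * (x + z * w) - y * (1 + w ^ 2)) /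
        ((1 + u ^ 2 + w ^ 2) * Real.sqrt (1 + u ^ 2 + w ^ 2)) = 0) :
    u * (x + z * w) = (1 + w ^ 2) * y := by
  have hN : 0 < 1 + u ^ 2 + w ^ 2 := by positivity
  have hs : 0 < Real.sqrt (1 + u ^ 2 + w ^ 2) := Real.sqrt_pos.mpr hN
  rw [div_eq_zero_iff] at h
  rcases h with h | h
  · have := (mul_eq_zero.mp h).resolve_left (by positivity)
    linarith
  · exact absurd h (by positivity)

/-- First-order conditions along the first coordinate. -/
theorem aux_coord (b x y z u w g : ℝ) (hb : 0 < b) (hu : u ∈ Set.Icc (-g) g)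
    (hm : IsLocalMinOn (fun t => hfun b x y z (t, w)) (Set.Icc (-g) g) u) :
    (|u| < g → u * (x + z * w) = (1 + w ^ 2) * y) ∧
    (u < g → 0 ≤ deriv (fun t => hfun b x y z (t, w)) u) ∧
    (-g < u → deriv (fun t => hfun b x y z (t, w)) u ≤ 0) := by
  have hd := aux_deriv b x y z u w
  have hs := aux_sign _ g u _ hu hd hm
  rw [hd.deriv]
  refine ⟨fun h => ?_, hs.1, hs.2⟩
  rw [abs_lt] at h
  exact aux_zero b x y z u w hb (le_antisymm (hs.2 h.1) (hs.1 h.2))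

/-- Theorem 1 for the minimization problem: every local minimizer of `h_i` on
`V` is one of the finitely many KKT candidate points of Table 1, and in each
case the stated first-order conditions hold. -/
theorem stmt_16 (b γa γe xi yi zi : ℝ) (hb : 0 < b) (hγa : 0 < γa) (hγe : 0 < γe)
    (hne : (xi, yi, zi) ≠ ((0 : ℝ), (0 : ℝ), (0 : ℝ)))
    (v : ℝ × ℝ) (hv : v ∈ Vbox γa γe)
    (hmin : IsLocalMinOn (hfun b xi yi zi) (Vbox γa γe) v) :
    (|v.1| < γa ∧ |v.2| < γe → xi ≠ 0 ∧ v = (yi / xi, zi / xi)) ∧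
    (v.1 = -γa ∧ |v.2| < γe →
      v.2 * (xi - γa * yi) = (1 + γa ^ 2) * zi ∧
      0 ≤ deriv (fun u => hfun b xi yi zi (u, v.2)) v.1) ∧
    (v.1 = γa ∧ |v.2| < γe →
      v.2 * (xi + γa * yi) = (1 + γa ^ 2) * zi ∧
      deriv (fun u => hfun b xi yi zi (u, v.2)) v.1 ≤ 0) ∧
    (|v.1| < γa ∧ v.2 = -γe →
      v.1 * (xi - γe * zi) = (1 + γe ^ 2) * yi ∧
      0 ≤ deriv (fun u => hfun b xi yi zi (v.1, u)) v.2) ∧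
    (|v.1| < γa ∧ v.2 = γe →
      v.1 * (xi + γe * zi) = (1 + γe ^ 2) * yi ∧
      deriv (fun u => hfun b xi yi zi (v.1, u)) v.2 ≤ 0) ∧
    (|v.1| = γa ∧ |v.2| = γe →
      (v.1 = -γa → 0 ≤ deriv (fun u => hfun b xi yi zi (u, v.2)) v.1) ∧
      (v.1 = γa → deriv (fun u => hfun b xi yi zi (u, v.2)) v.1 ≤ 0) ∧
      (v.2 = -γe → 0 ≤ deriv (fun u => hfun b xi yi zi (v.1, u)) v.2) ∧
      (v.2 = γe → deriv (fun u => hfun b xi yi zi (v.1, u)) v.2 ≤ 0)) := by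
  obtain ⟨p, q⟩ := v
  obtain ⟨hp, hq⟩ := hv
  simp only at hp hq ⊢
  have m1 : IsLocalMinOn (fun t => hfun b xi yi zi (t, q)) (Set.Icc (-γa) γa) p := by
    have ht : Filter.Tendsto (fun t : ℝ => (t, q)) (nhdsWithin p (Set.Icc (-γa) γa))
        (nhdsWithin (p, q) (Vbox γa γe)) :=
      ((by fun_prop : Continuous (fun t : ℝ => (t, q))).continuousWithinAt).tendsto_nhdsWithin
        (fun t ht => ⟨ht, hq⟩)
    exact ht.eventually hmin
  have m2 : IsLocalMinOn (fun t => hfun b xi yi zi (p, t)) (Set.Icc (-γe) γe) q := by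
    have ht : Filter.Tendsto (fun t : ℝ => (p, t)) (nhdsWithin q (Set.Icc (-γe) γe))
        (nhdsWithin (p, q) (Vbox γa γe)) :=
      ((by fun_prop : Continuous (fun t : ℝ => (p, t))).continuousWithinAt).tendsto_nhdsWithin
        (fun t ht => ⟨hp, ht⟩)
    exact ht.eventually hmin
  have e : (fun t => hfun b xi yi zi (p, t)) = fun t => hfun b xi zi yi (t, p) :=
    funext fun t => aux_swap b xi yi zi p t
  rw [e] at m2 ⊢
  obtain ⟨A1, A2, A3⟩ := aux_coord b xi yi zi p q γa hb hp m1
  obtain ⟨B1, B2, B3⟩ := aux_coord b xi zi yi q p γe hb hq m2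
  refine ⟨?_, ?_, ?_, ?_, ?_, ?_⟩
  · rintro ⟨h1, h2⟩
    have E1 := A1 h1
    have E2 := B1 h2
    have hN : (1 + p ^ 2 + q ^ 2) ≠ 0 := by positivity
    have Y : yi = p * xi := by
      apply mul_left_cancel₀ hN
      linear_combination (-(1 + p ^ 2)) * E1 - p * q * E2
    have Z : zi = q * xi := by
      apply mul_left_cancel₀ hN
      linear_combination (-(1 + q ^ 2)) * E2 - p * q * E1
    have hx : xi ≠ 0 := by
      rintro rfl
      exact hne (by simp [Y, Z])
    refine ⟨hx, ?_⟩
    rw [Y, Z]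
    field_simp
  · rintro ⟨rfl, h2⟩
    exact ⟨by linear_combination B1 h2, A2 (by linarith)⟩
  · rintro ⟨rfl, h2⟩
    exact ⟨by linear_combination B1 h2, A3 (by linarith)⟩
  · rintro ⟨h1, rfl⟩
    exact ⟨by linear_combination A1 h1, B2 (by linarith)⟩
  · rintro ⟨h1, rfl⟩
    exact ⟨by linear_combination A1 h1, B3 (by linarith)⟩
  · rintro -
    exact ⟨fun h => A2 (by linarith), fun h => A3 (by linarith),
      fun h => B2 (by linarith), fun h => B3 (by linarith)⟩
end
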